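/- For every positive integer n, in ℤ[q] one has ∑_{σ ∈ D_n} q^{exc^Clr(σ)} (−1)^{cyc(σ)} = −(q^2 − 1)^{n−1}, where D_n is the group of even signed permutations. -/

import Mathlib

open Finset Polynomial

/-- Number of excedances of a permutation: #{i : τ(i) > i}. -/
def exc {n : ℕ} (τ : Equiv.Perm (Fin n)) : ℕ :=
  (Finset.univ.filter fun i => i < τ i).card

/-- Number of cycles of a permutation, counting fixed points as cycles. -/
def cyc {n : ℕ} (τ : Equiv.Perm (Fin n)) : ℕ :=
  Multiset.card τ.cycleType + (Finset.univ.filter fun i => τ i = i).card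

/-- Color sum of a colored permutation. -/
def csum {r n : ℕ} (z : Fin n → Fin r) : ℕ := ∑ i, (z i : ℕ)

/-- #{i : z_i = 0 and τ(i) > i}. -/
def excA {r n : ℕ} (z : Fin n → Fin r) (τ : Equiv.Perm (Fin n)) : ℕ :=
  (Finset.univ.filter fun i => (z i : ℕ) = 0 ∧ i < τ i).card

/-- Excedance number with respect to the absolute order. -/
def excAbs {r n : ℕ} (z : Fin n → Fin r) (τ : Equiv.Perm (Fin n)) : ℕ :=
  exc τ + csum z

/-- Excedance number with respect to the color order. -/
def excClr {r n : ℕ} (z : Fin n → Fin r) (τ : Equiv.Perm (Fin n)) : ℕ :=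
  r * excA z τ + csum z

/-- A matrix with constant value `x` above the diagonal and `y` on and below it has determinant
`y * (y - x) ^ n`. -/
theorem det_ite_lt {R : Type*} [CommRing R] (n : ℕ) (x y : R) :
    (Matrix.of fun i j : Fin (n + 1) => if i < j then x else y).det = y * (y - x) ^ n := by
  let B : Matrix (Fin (n + 1)) (Fin (n + 1)) R := Matrix.of fun i j =>
    if i = 0 then (if i < j then x else y) else if i = j then y - x else 0
  have hB : (Matrix.of fun i j : Fin (n + 1) => if i < j then x else y).det = B.det := by
    refine Matrix.det_eq_of_forall_row_eq_smul_add_pred (fun _ => 1) (fun j => by simp [B]) ?_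
    intro i j
    simp only [B, Matrix.of_apply, Fin.succ_ne_zero, if_false, one_mul]
    simp only [Fin.lt_def, Fin.ext_iff, Fin.val_succ, Fin.val_castSucc]
    split_ifs <;> first | omega | simp
  have hT : B.BlockTriangular id := by
    intro i j hij
    have h0 : i ≠ 0 := ((Fin.zero_le j).trans_lt hij).ne'
    simp [B, h0, (show j < i from hij).ne']
  rw [hB, Matrix.det_of_isUpperTriangular hT, Fin.prod_univ_succ]
  simp [B, Fin.succ_ne_zero]

theorem neg_one_pow_cyc {n : ℕ} (τ : Equiv.Perm (Fin n)) :
    (-1 : ℤ[X]) ^ cyc τ = (-1) ^ n * ((Equiv.Perm.sign τ : ℤ) : ℤ[X]) := by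
  have hs : (Finset.univ.filter fun i => τ i = i).card + τ.cycleType.sum = n := by
    rw [Equiv.Perm.sum_cycleType]
    simpa [Equiv.Perm.support] using
      Finset.card_filter_add_card_filter_not (s := (Finset.univ : Finset (Fin n)))
        (fun i => τ i = i)
  rw [Equiv.Perm.sign_of_cycleType, cyc]
  push_cast
  rw [← pow_add]
  conv_rhs => enter [2, 1]; rw [← hs]
  rw [show ∀ a b c : ℕ, a + b + (b + c) = c + a + 2 * b by intros; ring, pow_add _ _ (2 * _),
    pow_mul]
  simp

/-- Summing over all colorings factors over the positions. -/
theorem sum_coloring {n : ℕ} (τ : Equiv.Perm (Fin n)) (c : ℤ[X]) :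
    ∑ z : Fin n → Fin 2, (X : ℤ[X]) ^ excClr z τ * c ^ csum z =
      ∏ i, if i < τ i then X ^ 2 + c * X else 1 + c * X := by
  have h : ∀ z : Fin n → Fin 2, (X : ℤ[X]) ^ excClr z τ * c ^ csum z =
      ∏ i, (X ^ (2 * if (z i : ℕ) = 0 ∧ i < τ i then 1 else 0) * (c * X) ^ (z i : ℕ)) := by
    intro z
    rw [Finset.prod_mul_distrib, Finset.prod_pow_eq_pow_sum, Finset.prod_pow_eq_pow_sum,
      ← Finset.mul_sum, ← Finset.card_filter, excClr, excA, csum, pow_add, mul_pow]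
    ring
  simp_rw [h]
  rw [← Fintype.prod_sum (fun (i : Fin n) (k : Fin 2) =>
    (X : ℤ[X]) ^ (2 * if (k : ℕ) = 0 ∧ i < τ i then 1 else 0) * (c * X) ^ (k : ℕ))]
  refine Finset.prod_congr rfl fun i _ => ?_
  split_ifs with hi <;> simp [Fin.sum_univ_two, hi]

theorem sum_signed_coloring (n : ℕ) (c : ℤ[X]) :
    ∑ σ : (Fin (n + 1) → Fin 2) × Equiv.Perm (Fin (n + 1)),
      (X : ℤ[X]) ^ excClr σ.1 σ.2 * (-1) ^ cyc σ.2 * c ^ csum σ.1 =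
    -(1 + c * X) * (X ^ 2 - 1) ^ n := by
  have hdet := det_ite_lt n ((X : ℤ[X]) ^ 2 + c * X) (1 + c * X)
  rw [← Matrix.det_transpose, Matrix.det_apply'] at hdet
  simp only [Matrix.transpose_apply, Matrix.of_apply] at hdet
  rw [Fintype.sum_prod_type_right]
  have h : ∀ τ : Equiv.Perm (Fin (n + 1)), ∑ z : Fin (n + 1) → Fin 2,
      (X : ℤ[X]) ^ excClr z τ * (-1) ^ cyc τ * c ^ csum z =
      (-1) ^ (n + 1) * (((Equiv.Perm.sign τ : ℤ) : ℤ[X]) *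
        ∏ i, if i < τ i then X ^ 2 + c * X else 1 + c * X) := by
    intro τ
    rw [← sum_coloring, ← mul_assoc, ← neg_one_pow_cyc, Finset.mul_sum]
    exact Finset.sum_congr rfl fun z _ => by ring
  simp_rw [h]
  rw [← Finset.mul_sum, hdet, show (1 + c * X - (X ^ 2 + c * X) : ℤ[X]) = -1 * (X ^ 2 - 1) by ring,
    mul_pow, pow_succ]
  have : ((-1 : ℤ[X]) ^ n) * (-1) ^ n = 1 := by rw [← mul_pow]; simp
  linear_combination (-(1 + c * X) * (X ^ 2 - 1) ^ n) * this

theorem stmt9 (n : ℕ) (hn : 0 < n) :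
    ∑ σ ∈ Finset.univ.filter
        (fun σ : (Fin n → Fin 2) × Equiv.Perm (Fin n) => Even (csum σ.1)),
      (X : Polynomial ℤ) ^ excClr σ.1 σ.2 * (-1) ^ cyc σ.2 =
    -((X : Polynomial ℤ) ^ 2 - 1) ^ (n - 1) := by
  obtain ⟨n, rfl⟩ := Nat.exists_eq_succ_of_ne_zero hn.ne'
  have h₁ := sum_signed_coloring n 1
  have h₂ := sum_signed_coloring n (-1)
  have key : (2 : ℤ[X]) * ∑ σ ∈ Finset.univ.filter
        (fun σ : (Fin (n + 1) → Fin 2) × Equiv.Perm (Fin (n + 1)) => Even (csum σ.1)),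
      (X : ℤ[X]) ^ excClr σ.1 σ.2 * (-1) ^ cyc σ.2 =
      -(1 + 1 * X) * (X ^ 2 - 1) ^ n + -(1 + -1 * X) * (X ^ 2 - 1) ^ n := by
    rw [← h₁, ← h₂, ← Finset.sum_add_distrib, Finset.sum_filter, Finset.mul_sum]
    refine Finset.sum_congr rfl fun σ _ => ?_
    split_ifs with h
    · rw [h.neg_one_pow, one_pow]; ring
    · rw [(Nat.not_even_iff_odd.mp h).neg_one_pow, one_pow]; ring
  refine mul_left_cancel₀ (two_ne_zero : (2 : ℤ[X]) ≠ 0) (key.trans ?_)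
  rw [Nat.succ_sub_one]
  ring
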